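/- Let n ≥ 2 and let f ∈ ℂ[x₁,…,xₙ] be a non-constant polynomial with f(0) = 0 which is convenient and non-degenerate at 0, and such that the hypersurface V = {f = 0} has an isolated singular point at 0. With the deformation setup (P, l, σ_y f, V_y, Ω) fixed, for every compact subset K ⊆ Ω there exists an open neighborhood U of 0 in ℂⁿ such that for every y ∈ K, the hypersurface V_y has no singular point in U ∖ {0}. -/

import Mathlib

open MvPolynomial

noncomputable section

/-- The exponent vector of a monomial, regarded as a point of `ℝⁿ`. -/
def expR {n : ℕ} (α : Fin n →₀ ℕ) : Fin n → ℝ := fun i => (α i : ℝ)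

/-- The convex hull of the union, over `α ∈ s`, of the translates `α + ℝ₊ⁿ` of the
nonnegative orthant. -/
def newtonRegion {n : ℕ} (s : Set (Fin n →₀ ℕ)) : Set (Fin n → ℝ) :=
  convexHull ℝ {x | ∃ α ∈ s, ∃ r : Fin n → ℝ, (∀ i, 0 ≤ r i) ∧ x = expR α + r}

/-- The Newton polyhedron `Γ₊(f)` of `f` at the origin. -/
def NewtonPolyhedron {n : ℕ} (f : MvPolynomial (Fin n) ℂ) : Set (Fin n → ℝ) :=
  newtonRegion {α | α ∈ f.support}

/-- The union of all bounded (nonempty, exposed) faces of `A`. -/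
def boundedFacesUnion {n : ℕ} (A : Set (Fin n → ℝ)) : Set (Fin n → ℝ) :=
  {x | ∃ F : Set (Fin n → ℝ), F.Nonempty ∧ IsExposed ℝ A F ∧
    Bornology.IsBounded F ∧ x ∈ F}

/-- The Newton boundary `Γ_f` of `f`: the union of the bounded faces of `Γ₊(f)`. -/
def NewtonBoundary {n : ℕ} (f : MvPolynomial (Fin n) ℂ) : Set (Fin n → ℝ) :=
  boundedFacesUnion (NewtonPolyhedron f)

/-- `f` is convenient: `Γ₊(f)` meets the positive part of every coordinate axis. -/
def Convenient {n : ℕ} (f : MvPolynomial (Fin n) ℂ) : Prop :=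
  ∀ i : Fin n, ∃ t : ℝ, 0 < t ∧ Pi.single i t ∈ NewtonPolyhedron f

open Classical in
/-- The part `f_F` of `f` supported on a subset `F ⊆ ℝⁿ`. -/
def faceRestrict {n : ℕ} (f : MvPolynomial (Fin n) ℂ) (F : Set (Fin n → ℝ)) :
    MvPolynomial (Fin n) ℂ :=
  ∑ α ∈ f.support.filter (fun α => expR α ∈ F), monomial α (f.coeff α)

/-- The system `g = ∂g/∂x₁ = ⋯ = ∂g/∂xₙ = 0` has a solution in `(ℂ ∖ {0})ⁿ`. -/
def hasTorusSolution {n : ℕ} (g : MvPolynomial (Fin n) ℂ) : Prop :=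
  ∃ x : Fin n → ℂ, (∀ i, x i ≠ 0) ∧ eval x g = 0 ∧ ∀ i, eval x (pderiv i g) = 0

/-- `f` is non-degenerate at `0`: for every bounded face `F` of `Γ₊(f)` the system
`f_F = ∂f_F/∂x₁ = ⋯ = ∂f_F/∂xₙ = 0` has no solution in the torus. -/
def NondegAtZero {n : ℕ} (f : MvPolynomial (Fin n) ℂ) : Prop :=
  ∀ F : Set (Fin n → ℝ), F.Nonempty → IsExposed ℝ (NewtonPolyhedron f) F →
    Bornology.IsBounded F → ¬ hasTorusSolution (faceRestrict f F)

/-- `x` is a singular point of the hypersurface `{h = 0} ⊆ ℂⁿ`. -/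
def IsSingularPt {n : ℕ} (h : MvPolynomial (Fin n) ℂ) (x : Fin n → ℂ) : Prop :=
  eval x h = 0 ∧ ∀ i, eval x (pderiv i h) = 0

/-- The deformed polynomial `σ_y f = Σ_α (a_α + y_α) x^α`. -/
def perturb {n : ℕ} (f : MvPolynomial (Fin n) ℂ) (S : Finset (Fin n →₀ ℕ))
    (y : {α // α ∈ S} → ℂ) : MvPolynomial (Fin n) ℂ :=
  f + ∑ α ∈ S.attach, monomial α.1 (y α)

/-- The parameter set `Ω ⊆ ℂ^{P ∩ ℤⁿ}`. -/
def Omega {n : ℕ} (f : MvPolynomial (Fin n) ℂ) (S : Finset (Fin n →₀ ℕ)) :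
    Set ({α // α ∈ S} → ℂ) :=
  {y | NewtonBoundary (perturb f S y) = NewtonBoundary f ∧ NondegAtZero (perturb f S y)}

open Filter Topology

theorem lt_dotProduct_of_mem_newtonRegion {n : ℕ} {s : Set (Fin n →₀ ℕ)} {w : Fin n → ℝ}
    (hw : ∀ i, 0 ≤ w i) {m : ℝ} (h : ∀ α ∈ s, m < w ⬝ᵥ expR α) {p : Fin n → ℝ}
    (hp : p ∈ newtonRegion s) : m < w ⬝ᵥ p := by
  have hc : Convex ℝ {p : Fin n → ℝ | m < w ⬝ᵥ p} :=
    convex_halfSpace_gt ⟨dotProduct_add w, fun c x => dotProduct_smul c w x⟩ m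
  refine convexHull_min ?_ hc hp
  rintro _ ⟨α, hα, r, hr, rfl⟩
  have h1 : 0 ≤ w ⬝ᵥ r := Finset.sum_nonneg fun i _ => mul_nonneg (hw i) (hr i)
  have h2 := h α hα
  change m < w ⬝ᵥ (expR α + r)
  rw [dotProduct_add]
  linarith

theorem le_dotProduct_of_mem_newtonRegion {n : ℕ} {s : Set (Fin n →₀ ℕ)} {w : Fin n → ℝ}
    (hw : ∀ i, 0 ≤ w i) {m : ℝ} (h : ∀ α ∈ s, m ≤ w ⬝ᵥ expR α) {p : Fin n → ℝ}
    (hp : p ∈ newtonRegion s) : m ≤ w ⬝ᵥ p :=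
  le_of_forall_lt fun _ hc =>
    lt_dotProduct_of_mem_newtonRegion hw (fun α hα => hc.trans_le (h α hα)) hp

theorem expR_mem_newtonRegion {n : ℕ} {s : Set (Fin n →₀ ℕ)} {α : Fin n →₀ ℕ} (hα : α ∈ s) :
    expR α ∈ newtonRegion s :=
  subset_convexHull ℝ _ ⟨α, hα, 0, fun _ => le_rfl, by simp⟩

theorem nonneg_of_mem_newtonRegion {n : ℕ} {s : Set (Fin n →₀ ℕ)} {p : Fin n → ℝ}
    (hp : p ∈ newtonRegion s) (i : Fin n) : 0 ≤ p i := by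
  have h := le_dotProduct_of_mem_newtonRegion (w := Pi.single i 1) (m := 0) (s := s)
    (fun j => by by_cases h : j = i <;> simp [h])
    (fun α _ => by simp [expR]) hp
  simpa using h

/-- The face of `A` on which the weight `w` is minimal. -/
def weightFace {n : ℕ} (w : Fin n → ℝ) (A : Set (Fin n → ℝ)) : Set (Fin n → ℝ) :=
  {p ∈ A | ∀ q ∈ A, w ⬝ᵥ p ≤ w ⬝ᵥ q}

theorem isExposed_weightFace {n : ℕ} (w : Fin n → ℝ) (A : Set (Fin n → ℝ)) :
    IsExposed ℝ A (weightFace w A) := by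
  intro _
  let l : (Fin n → ℝ) →ₗ[ℝ] ℝ :=
    { toFun := fun p => -(w ⬝ᵥ p)
      map_add' := fun x y => by rw [dotProduct_add]; ring
      map_smul' := fun c x => by simp [dotProduct_smul] }
  refine ⟨LinearMap.toContinuousLinearMap l, ?_⟩
  ext p
  simp [weightFace, l]

theorem isBounded_weightFace {n : ℕ} {s : Set (Fin n →₀ ℕ)} {w : Fin n → ℝ}
    (hw : ∀ i, 0 < w i) : Bornology.IsBounded (weightFace w (newtonRegion s)) := by
  rcases (weightFace w (newtonRegion s)).eq_empty_or_nonempty with h | ⟨p₀, hp₀, -⟩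
  · rw [h]; exact Bornology.isBounded_empty
  · refine (Metric.isBounded_Icc (0 : Fin n → ℝ) (fun i => w ⬝ᵥ p₀ / w i)).subset ?_
    rintro p ⟨hp, hmin⟩
    have hp0 := nonneg_of_mem_newtonRegion hp
    refine ⟨hp0, fun i => ?_⟩
    rw [le_div_iff₀ (hw i), mul_comm]
    exact (Finset.single_le_sum (f := fun j => w j * p j)
      (fun j _ => mul_nonneg (hw j).le (hp0 j)) (Finset.mem_univ i)).trans (hmin p₀ hp₀)

theorem expR_mem_weightFace {n : ℕ} {s : Set (Fin n →₀ ℕ)} {w : Fin n → ℝ}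
    (hw : ∀ i, 0 < w i) {α : Fin n →₀ ℕ} (hα : α ∈ s)
    (hmin : ∀ β ∈ s, w ⬝ᵥ expR α ≤ w ⬝ᵥ expR β) :
    expR α ∈ weightFace w (newtonRegion s) :=
  ⟨expR_mem_newtonRegion hα, fun _ hq =>
    le_dotProduct_of_mem_newtonRegion (fun i => (hw i).le) hmin hq⟩

theorem boundedFacesUnion_subset {n : ℕ} (A : Set (Fin n → ℝ)) : boundedFacesUnion A ⊆ A := by
  rintro x ⟨F, -, hF, -, hx⟩
  exact hF.subset hx

/-- If the Newton boundaries of `f` and `g` agree, then every point of `Γ₊(f)` is dominated,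
with respect to a positive weight, by an exponent of `g`. -/
theorem exists_support_dotProduct_le {n : ℕ} {f g : MvPolynomial (Fin n) ℂ}
    (h : NewtonBoundary g = NewtonBoundary f) {w : Fin n → ℝ} (hw : ∀ i, 0 < w i)
    {p : Fin n → ℝ} (hp : p ∈ NewtonPolyhedron f) :
    ∃ β ∈ g.support, w ⬝ᵥ expR β ≤ w ⬝ᵥ p := by
  obtain ⟨γ, hγ, hγp⟩ : ∃ γ ∈ f.support, w ⬝ᵥ expR γ ≤ w ⬝ᵥ p := by
    by_contra! hcon
    exact lt_irrefl _ (lt_dotProduct_of_mem_newtonRegion (fun i => (hw i).le) hcon hp)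
  obtain ⟨α, hα, hmin⟩ := f.support.exists_min_image (fun α => w ⬝ᵥ expR α) ⟨γ, hγ⟩
  have hface : expR α ∈ weightFace w (NewtonPolyhedron f) := expR_mem_weightFace hw hα hmin
  have hmem : expR α ∈ NewtonBoundary f :=
    ⟨_, ⟨_, hface⟩, isExposed_weightFace _ _, isBounded_weightFace hw, hface⟩
  rw [← h] at hmem
  have hg : expR α ∈ NewtonPolyhedron g := boundedFacesUnion_subset _ hmem
  by_contra! hcon
  have h1 := lt_dotProduct_of_mem_newtonRegion (fun i => (hw i).le) hcon hg
  exact absurd ((hmin γ hγ).trans hγp) (not_le.2 h1)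

theorem not_hasTorusSolution_sum_filter {n : ℕ} {f g : MvPolynomial (Fin n) ℂ}
    (h : NewtonBoundary g = NewtonBoundary f) (hg : NondegAtZero g)
    {A : Finset (Fin n →₀ ℕ)} (hgA : g.support ⊆ A)
    (hA : ∀ α ∈ A, expR α ∈ NewtonPolyhedron f) {w : Fin n → ℝ} (hw : ∀ i, 0 < w i)
    {α₀ : Fin n →₀ ℕ} (hα₀ : α₀ ∈ A) (hmin : ∀ α ∈ A, w ⬝ᵥ expR α₀ ≤ w ⬝ᵥ expR α) :
    ¬ hasTorusSolution
      (∑ α ∈ A with w ⬝ᵥ expR α = w ⬝ᵥ expR α₀, monomial α (g.coeff α)) := by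
  classical
  obtain ⟨β, hβ, hβle⟩ := exists_support_dotProduct_le h hw (hA α₀ hα₀)
  have hβeq : w ⬝ᵥ expR β = w ⬝ᵥ expR α₀ := le_antisymm hβle (hmin β (hgA hβ))
  have hface : expR β ∈ weightFace w (NewtonPolyhedron g) :=
    expR_mem_weightFace hw hβ fun γ hγ => hβle.trans (hmin γ (hgA hγ))
  have hiff : ∀ γ ∈ g.support, expR γ ∈ weightFace w (NewtonPolyhedron g) ↔
      w ⬝ᵥ expR γ = w ⬝ᵥ expR α₀ := by
    intro γ hγ
    constructor
    · intro h1
      exact le_antisymm (hβeq ▸ h1.2 _ hface.1) (hmin γ (hgA hγ))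
    · intro h1
      exact expR_mem_weightFace hw hγ fun δ hδ => h1.le.trans (hmin δ (hgA hδ))
  have key := hg _ ⟨_, hface⟩ (isExposed_weightFace _ _) (isBounded_weightFace hw)
  suffices heq : faceRestrict g (weightFace w (NewtonPolyhedron g)) =
      ∑ α ∈ A with w ⬝ᵥ expR α = w ⬝ᵥ expR α₀, monomial α (g.coeff α) from heq ▸ key
  unfold faceRestrict
  apply Finset.sum_subset_zero_on_sdiff
  · intro γ hγ
    rw [Finset.mem_filter] at hγ ⊢
    exact ⟨hgA hγ.1, (hiff γ hγ.1).1 hγ.2⟩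
  · intro γ hγ
    rw [Finset.mem_sdiff, Finset.mem_filter, Finset.mem_filter] at hγ
    by_cases hs : γ ∈ g.support
    · exact absurd ⟨hs, (hiff γ hs).2 hγ.1.2⟩ hγ.2
    · rw [notMem_support_iff.1 hs, map_zero]
  · intros; rfl

theorem exists_support_eq_zero_off {n : ℕ} {f : MvPolynomial (Fin n) ℂ} (hf : Convenient f)
    (i : Fin n) : ∃ α ∈ f.support, ∀ j, j ≠ i → α j = 0 := by
  obtain ⟨t, -, ht⟩ := hf i
  by_contra! hcon
  have h := lt_dotProduct_of_mem_newtonRegion (w := fun j => if j = i then 0 else 1) (m := 0)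
    (fun j => by split_ifs <;> norm_num) (fun α hα => ?_) ht
  · simp at h
  · obtain ⟨j, hj, hαj⟩ := hcon α hα
    refine Finset.sum_pos' (fun k _ => ?_) ⟨j, Finset.mem_univ j, ?_⟩
    · simp only [expR]; split_ifs <;> simp
    · simpa [expR, hj] using Nat.pos_of_ne_zero hαj

/-- Along an ultrafilter, a family of weights can be corrected by a bounded amount so that, on a
finite set of vectors, each value exceeds the least one either by exactly `0` or by an amount
that tends to infinity. -/
theorem exists_bounded_correction {ι κ : Type*} {n : ℕ} (l : Ultrafilter ι)
    (u : ι → Fin n → ℝ) (e : κ → Fin n → ℝ) {A : Finset κ} (hA : A.Nonempty) :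
    ∃ a₀ ∈ A, ∃ b : ι → Fin n → ℝ, ∃ B : ℝ, (∀ᶠ k in l, ∀ i, |b k i| ≤ B) ∧
      ∀ a ∈ A, (∀ k, (u k - b k) ⬝ᵥ e a = (u k - b k) ⬝ᵥ e a₀) ∨
        Tendsto (fun k => (u k - b k) ⬝ᵥ e a - (u k - b k) ⬝ᵥ e a₀) l atTop := by
  classical
  obtain ⟨a₀, ha₀, hmin⟩ : ∃ a₀ ∈ A, ∀ᶠ k in l, ∀ a ∈ A, u k ⬝ᵥ e a₀ ≤ u k ⬝ᵥ e a := by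
    have h : ∀ᶠ k in l, ∃ a₀ ∈ A, ∀ a ∈ A, u k ⬝ᵥ e a₀ ≤ u k ⬝ᵥ e a :=
      Eventually.of_forall fun k => A.exists_min_image (fun a => u k ⬝ᵥ e a) hA
    exact (Ultrafilter.eventually_exists_mem_iff A.finite_toSet).1 h
  let F := A.filter fun a => ¬ Tendsto (fun k => u k ⬝ᵥ e a - u k ⬝ᵥ e a₀) l atTop
  let L : (Fin n → ℝ) →ₗ[ℝ] (F → ℝ) :=
    { toFun := fun v a => v ⬝ᵥ (e a.1 - e a₀)
      map_add' := fun x y => by ext a; exact add_dotProduct _ _ _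
      map_smul' := fun c x => by ext a; exact smul_dotProduct _ _ _ }
  obtain ⟨R₀, hR₀⟩ := L.rangeRestrict.exists_rightInverse_of_surjective L.range_rangeRestrict
  obtain ⟨R, hR⟩ := R₀.exists_extend
  have hLR : ∀ v, L (R (L v)) = L v := by
    intro v
    have h1 : R (L v) = R₀ (L.rangeRestrict v) := by rw [← hR]; rfl
    have h2 := LinearMap.congr_fun hR₀ (L.rangeRestrict v)
    rw [h1]
    exact congrArg Subtype.val h2
  obtain ⟨C, hC⟩ : ∃ C : ℝ, ∀ᶠ k in l, ∀ a : F, |L (u k) a| ≤ C := by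
    have h1 : ∀ a : F, ∃ C : ℝ, ∀ᶠ k in l, |L (u k) a| ≤ C := by
      intro a
      obtain ⟨haA, ha⟩ := Finset.mem_filter.1 a.2
      rw [tendsto_atTop] at ha
      push Not at ha
      obtain ⟨C, hC⟩ := ha
      refine ⟨C, ?_⟩
      filter_upwards [hC, hmin] with k hk hk'
      have := hk' a haA
      simp only [L, LinearMap.coe_mk, AddHom.coe_mk, dotProduct_sub]
      rw [abs_of_nonneg (by linarith)]
      linarith
    choose C hC using h1
    refine ⟨∑ a, |C a|, ?_⟩
    filter_upwards [eventually_all.2 hC] with k hk a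
    exact (hk a).trans ((le_abs_self _).trans (Finset.single_le_sum (f := fun a => |C a|)
      (fun _ _ => abs_nonneg _) (Finset.mem_univ a)))
  obtain ⟨B, hB⟩ : ∃ B : ℝ, ∀ᶠ k in l, ∀ i, |R (L (u k)) i| ≤ B := by
    let R' := LinearMap.toContinuousLinearMap R
    refine ⟨‖R'‖ * max C 0, ?_⟩
    filter_upwards [hC] with k hk i
    calc |R (L (u k)) i| ≤ ‖R' (L (u k))‖ := norm_le_pi_norm (R (L (u k))) i
      _ ≤ ‖R'‖ * ‖L (u k)‖ := R'.le_opNorm _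
      _ ≤ ‖R'‖ * max C 0 := by
        gcongr
        exact (pi_norm_le_iff_of_nonneg (le_max_right _ _)).2 fun a =>
          (hk a).trans (le_max_left _ _)
  refine ⟨a₀, ha₀, fun k => R (L (u k)), B, hB, fun a ha => ?_⟩
  by_cases haF : Tendsto (fun k => u k ⬝ᵥ e a - u k ⬝ᵥ e a₀) l atTop
  · right
    have hsplit : ∀ k, (u k - R (L (u k))) ⬝ᵥ e a - (u k - R (L (u k))) ⬝ᵥ e a₀ =
        (u k ⬝ᵥ e a - u k ⬝ᵥ e a₀) + -(R (L (u k)) ⬝ᵥ (e a - e a₀)) := fun k => by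
      simp only [sub_dotProduct, dotProduct_sub]; ring
    simp only [hsplit]
    refine tendsto_atTop_add_right_of_le' _ (-∑ i, B * |(e a - e a₀) i|) haF ?_
    filter_upwards [hB] with k hk
    refine neg_le_neg (Finset.sum_le_sum fun i _ => ?_)
    refine (le_abs_self _).trans ?_
    rw [abs_mul]
    exact mul_le_mul_of_nonneg_right (hk i) (abs_nonneg _)
  · left
    intro k
    have h1 := congrFun (hLR (u k)) ⟨a, Finset.mem_filter.2 ⟨ha, haF⟩⟩
    change R (L (u k)) ⬝ᵥ (e a - e a₀) = u k ⬝ᵥ (e a - e a₀) at h1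
    rw [dotProduct_sub, dotProduct_sub] at h1
    rw [sub_dotProduct, sub_dotProduct]
    linarith

theorem mul_eval_pderiv_sum_monomial {n : ℕ} (T : Finset (Fin n →₀ ℕ))
    (c : (Fin n →₀ ℕ) → ℂ) (x : Fin n → ℂ) (j : Fin n) :
    x j * eval x (pderiv j (∑ α ∈ T, monomial α (c α))) =
      ∑ α ∈ T, c α * α j * ∏ i, x i ^ α i := by
  have h : X j * pderiv j (∑ α ∈ T, monomial α (c α)) =
      ∑ α ∈ T, (α j) • monomial α (c α) := by
    simp only [map_sum, Finset.mul_sum, X_mul_pderiv_monomial]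
  have h2 := congrArg (eval x) h
  rw [map_mul, eval_X] at h2
  rw [h2, map_sum]
  refine Finset.sum_congr rfl fun α _ => ?_
  rw [map_nsmul, eval_monomial, Finsupp.prod_fintype _ _ (fun _ => pow_zero _), nsmul_eq_mul]
  ring

theorem eval_sum_monomial {n : ℕ} (T : Finset (Fin n →₀ ℕ))
    (c : (Fin n →₀ ℕ) → ℂ) (x : Fin n → ℂ) :
    eval x (∑ α ∈ T, monomial α (c α)) = ∑ α ∈ T, c α * ∏ i, x i ^ α i := by
  rw [map_sum]
  refine Finset.sum_congr rfl fun α _ => ?_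
  rw [eval_monomial, Finsupp.prod_fintype _ _ (fun _ => pow_zero _)]

theorem coeff_perturb {n : ℕ} (f : MvPolynomial (Fin n) ℂ) (S : Finset (Fin n →₀ ℕ))
    (y : {α // α ∈ S} → ℂ) (β : Fin n →₀ ℕ) :
    (perturb f S y).coeff β = f.coeff β + ∑ α ∈ S.attach, if α.1 = β then y α else 0 := by
  classical
  simp only [perturb, coeff_add, coeff_sum, coeff_monomial]

theorem continuous_coeff_perturb {n : ℕ} (f : MvPolynomial (Fin n) ℂ)
    (S : Finset (Fin n →₀ ℕ)) (β : Fin n →₀ ℕ) :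
    Continuous fun y => (perturb f S y).coeff β := by
  simp only [coeff_perturb]
  refine continuous_const.add (continuous_finsetSum _ fun α _ => ?_)
  split_ifs
  · exact continuous_apply α
  · exact continuous_const

theorem support_perturb_subset {n : ℕ} (f : MvPolynomial (Fin n) ℂ)
    (S : Finset (Fin n →₀ ℕ)) (y : {α // α ∈ S} → ℂ) :
    (perturb f S y).support ⊆ f.support ∪ S := by
  intro β hβ
  by_contra hcon
  rw [Finset.mem_union, not_or] at hcon
  rw [mem_support_iff, coeff_perturb, notMem_support_iff.1 hcon.1, zero_add] at hβ
  refine hβ (Finset.sum_eq_zero fun α _ => if_neg ?_)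
  rintro rfl
  exact hcon.2 α.2


/-- A net in the torus can be rescaled by weights to converge in the torus, such that on a finite
set of exponents each weight is either exactly minimal or infinitely larger than the minimum. -/
theorem exists_torus_limit {ι : Type*} {n : ℕ} (l : Ultrafilter ι) (x : ι → Fin n → ℂ)
    (hx : ∀ k i, x k i ≠ 0) {A : Finset (Fin n →₀ ℕ)} (hA : A.Nonempty) :
    ∃ F ⊆ A, ∃ α₀ ∈ F, ∃ w : ι → Fin n → ℝ, ∃ z : Fin n → ℂ, (∀ i, z i ≠ 0) ∧
      Tendsto (fun k i => x k i * Real.exp (w k i)) l (𝓝 z) ∧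
      (∀ α ∈ F, ∀ k, w k ⬝ᵥ expR α = w k ⬝ᵥ expR α₀) ∧
      ∀ α ∈ A, α ∉ F → Tendsto (fun k => w k ⬝ᵥ expR α - w k ⬝ᵥ expR α₀) l atTop := by
  classical
  obtain ⟨α₀, hα₀, b, B, hB, hdich⟩ :=
    exists_bounded_correction l (fun k i => -Real.log ‖x k i‖) expR hA
  set w : ι → Fin n → ℝ := fun k => (fun i => -Real.log ‖x k i‖) - b k with hw
  have hnorm : ∀ k i, ‖x k i * Real.exp (w k i)‖ = Real.exp (-b k i) := by
    intro k i
    have hpos : 0 < ‖x k i‖ := norm_pos_iff.2 (hx k i)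
    rw [norm_mul, Complex.norm_real, Real.norm_of_nonneg (Real.exp_pos _).le]
    simp only [hw, Pi.sub_apply]
    rw [sub_eq_add_neg, Real.exp_add, Real.exp_neg, Real.exp_log hpos, ← mul_assoc,
      mul_inv_cancel₀ hpos.ne', one_mul]
  have hcpt : IsCompact (Set.univ.pi fun _ : Fin n =>
      Metric.closedBall (0 : ℂ) (Real.exp B) ∩ {v | Real.exp (-B) ≤ ‖v‖}) :=
    isCompact_univ_pi fun _ => (isCompact_closedBall _ _).inter_right
      (isClosed_le continuous_const continuous_norm)
  obtain ⟨z, hz, hlim⟩ := hcpt.ultrafilter_le_nhds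
    (l.map fun k i => x k i * (Real.exp (w k i) : ℂ)) (by
      rw [le_principal_iff]
      change ∀ᶠ k in (l : Filter ι), _
      filter_upwards [hB] with k hk i _
      have h1 := abs_le.1 (hk i)
      refine ⟨?_, ?_⟩
      · rw [mem_closedBall_zero_iff, hnorm]
        exact Real.exp_le_exp.2 (by linarith)
      · change Real.exp (-B) ≤ ‖x k i * (Real.exp (w k i) : ℂ)‖
        rw [hnorm]
        exact Real.exp_le_exp.2 (by linarith))
  refine ⟨A.filter fun α => ∀ k, w k ⬝ᵥ expR α = w k ⬝ᵥ expR α₀, Finset.filter_subset _ _, α₀,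
    by simp [hα₀], w, z, fun i => ?_, hlim, fun α hα => (Finset.mem_filter.1 hα).2,
    fun α hα hαF => ?_⟩
  · exact norm_pos_iff.1 ((Real.exp_pos _).trans_le (hz i (Set.mem_univ i)).2)
  · exact (hdich α hα).resolve_left fun h => hαF (Finset.mem_filter.2 ⟨hα, h⟩)

theorem prod_mul_exp_pow {n : ℕ} (x : Fin n → ℂ) (w : Fin n → ℝ) (α : Fin n →₀ ℕ) :
    ∏ i, (x i * (Real.exp (w i) : ℂ)) ^ α i =
      (∏ i, x i ^ α i) * (Real.exp (w ⬝ᵥ expR α) : ℂ) := by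
  simp only [mul_pow, Finset.prod_mul_distrib, dotProduct, Real.exp_sum, Complex.ofReal_prod]
  congr 1
  refine Finset.prod_congr rfl fun i _ => ?_
  rw [expR, mul_comm (w i), Real.exp_nat_mul, Complex.ofReal_pow]

/-- Only the terms of minimal weight survive in the limit of a rescaled equation. -/
theorem sum_minimal_terms_eq_zero {ι : Type*} {n : ℕ} {l : Filter ι} [l.NeBot]
    {x : ι → Fin n → ℂ} {w : ι → Fin n → ℝ} {z : Fin n → ℂ}
    (hlim : Tendsto (fun k i => x k i * (Real.exp (w k i) : ℂ)) l (𝓝 z))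
    {A F : Finset (Fin n →₀ ℕ)} (hFA : F ⊆ A) {α₀ : Fin n →₀ ℕ}
    (hF : ∀ α ∈ F, ∀ k, w k ⬝ᵥ expR α = w k ⬝ᵥ expR α₀)
    (hA : ∀ α ∈ A, α ∉ F → Tendsto (fun k => w k ⬝ᵥ expR α - w k ⬝ᵥ expR α₀) l atTop)
    {c : ι → (Fin n →₀ ℕ) → ℂ} {c₀ : (Fin n →₀ ℕ) → ℂ}
    (hc : ∀ α ∈ A, Tendsto (fun k => c k α) l (𝓝 (c₀ α)))
    (hzero : ∀ᶠ k in l, ∑ α ∈ A, c k α * ∏ i, x k i ^ α i = 0) :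
    ∑ α ∈ F, c₀ α * ∏ i, z i ^ α i = 0 := by
  classical
  have hprod : ∀ α : Fin n →₀ ℕ, Tendsto (fun k => ∏ i, (x k i * (Real.exp (w k i) : ℂ)) ^ α i) l
      (𝓝 (∏ i, z i ^ α i)) := fun α =>
    tendsto_finsetProd _ fun i _ => (tendsto_pi_nhds.1 hlim i).pow (α i)
  have hexp : ∀ α ∈ A, Tendsto
      (fun k => (Real.exp (-(w k ⬝ᵥ expR α - w k ⬝ᵥ expR α₀)) : ℂ)) l
      (𝓝 (if α ∈ F then 1 else 0)) := by
    intro α hα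
    by_cases hαF : α ∈ F
    · simp [hF α hαF, hαF]
    · rw [if_neg hαF, ← Complex.ofReal_zero]
      exact (Complex.continuous_ofReal.tendsto 0).comp
        (Real.tendsto_exp_neg_atTop_nhds_zero.comp (hA α hα hαF))
  have hsum := tendsto_finsetSum A fun α hα => ((hc α hα).mul (hprod α)).mul (hexp α hα)
  have hev : (fun k => ∑ α ∈ A, c k α * (∏ i, (x k i * (Real.exp (w k i) : ℂ)) ^ α i) *
      (Real.exp (-(w k ⬝ᵥ expR α - w k ⬝ᵥ expR α₀)) : ℂ)) =ᶠ[l] fun _ => 0 := by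
    filter_upwards [hzero] with k hk
    rw [← zero_mul (Real.exp (w k ⬝ᵥ expR α₀) : ℂ), ← hk, Finset.sum_mul]
    refine Finset.sum_congr rfl fun α _ => ?_
    rw [prod_mul_exp_pow, neg_sub, mul_assoc, mul_assoc, mul_assoc, ← Complex.ofReal_mul,
      ← Real.exp_add, add_sub_cancel]
  have h0 := tendsto_nhds_unique (tendsto_const_nhds.congr' hev.symm) hsum
  rw [h0]
  simp only [mul_ite, mul_one, mul_zero]
  rw [← Finset.sum_filter, Finset.filter_mem_eq_inter, Finset.inter_eq_right.2 hFA]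

/-- Lemma 5.2 (Lemma~`koritu`): for every compact `K ⊆ Ω` there is a neighborhood `U`
of `0` in `ℂⁿ` such that for every `y ∈ K` the only possible singular point of
`V_y = {σ_y f = 0}` in `U` is the origin. -/
theorem stmt1 (n : ℕ) (hn : 2 ≤ n) (f : MvPolynomial (Fin n) ℂ)
    (hfnc : ¬ ∃ c : ℂ, f = C c) (hf0 : eval (0 : Fin n → ℂ) f = 0)
    (hconv : Convenient f) (hnd : NondegAtZero f)
    -- `0` is an isolated singular point of `V = {f = 0}`
    (hsing : IsSingularPt f 0)
    (hiso : ∃ U : Set (Fin n → ℂ), IsOpen U ∧ (0 : Fin n → ℂ) ∈ U ∧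
      ∀ x ∈ U, x ≠ 0 → ¬ IsSingularPt f x)
    -- the deformation setup: a polytope `P ⊆ Γ₊(f)` whose lattice points are `S`,
    -- such that the Newton boundary determined by `S` equals `Γ_f`
    (P : Set (Fin n → ℝ)) (hPpoly : ∃ T : Finset (Fin n → ℝ), P = convexHull ℝ ↑T)
    (hPsub : P ⊆ NewtonPolyhedron f)
    (S : Finset (Fin n →₀ ℕ)) (hS : ∀ α : Fin n →₀ ℕ, α ∈ S ↔ expR α ∈ P)
    (hPface : boundedFacesUnion (newtonRegion {α | α ∈ S}) = NewtonBoundary f)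
    -- a compact subset of `Ω`
    (K : Set ({α // α ∈ S} → ℂ)) (hKsub : K ⊆ Omega f S) (hKc : IsCompact K) :
    ∃ U : Set (Fin n → ℂ), IsOpen U ∧ (0 : Fin n → ℂ) ∈ U ∧
      ∀ y ∈ K, ∀ x ∈ U, x ≠ 0 → ¬ IsSingularPt (perturb f S y) x := by
  classical
  by_contra hcon
  have hseq : ∀ k : ℕ, ∃ y ∈ K, ∃ x ∈ Metric.ball (0 : Fin n → ℂ) (1 / ((k : ℝ) + 1)), x ≠ 0 ∧
      IsSingularPt (perturb f S y) x := by
    intro k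
    by_contra! h
    exact hcon ⟨_, Metric.isOpen_ball, Metric.mem_ball_self Nat.one_div_pos_of_nat, h⟩
  choose y hyK x hxball hx0 hxsing using hseq
  let l : Ultrafilter ℕ := hyperfilter ℕ
  have hxlim : Tendsto x l (𝓝 0) := by
    refine Tendsto.mono_left ?_ Nat.hyperfilter_le_atTop
    rw [tendsto_iff_dist_tendsto_zero]
    exact squeeze_zero (fun _ => dist_nonneg) (fun k => (Metric.mem_ball.1 (hxball k)).le)
      tendsto_one_div_add_atTop_nhds_zero_nat
  obtain ⟨y₀, hy₀K, hylim⟩ := hKc.ultrafilter_le_nhds (l.map y)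
    (le_principal_iff.2 (Eventually.of_forall hyK : ∀ᶠ k in l, y k ∈ K))
  replace hylim : Tendsto y l (𝓝 y₀) := hylim
  obtain ⟨hy₀bd, hy₀nd⟩ := hKsub hy₀K
  let I : Fin n → Prop := fun i => ∀ᶠ k in l, x k i ≠ 0
  have hI : ∀ᶠ k in l, ∀ i, x k i = 0 ↔ ¬ I i := by
    refine eventually_all.2 fun i => ?_
    by_cases hi : I i
    · filter_upwards [hi] with k hk
      simp [hi, hk]
    · filter_upwards [Ultrafilter.eventually_not.2 hi] with k hk
      simpa [hi] using hk
  obtain ⟨i₀, hi₀⟩ : ∃ i, I i := by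
    obtain ⟨k, hk⟩ := hI.exists
    obtain ⟨i, hi⟩ := Function.ne_iff.1 (hx0 k)
    exact ⟨i, by_contra fun h => hi ((hk i).2 h)⟩
  let A : Finset (Fin n →₀ ℕ) := f.support ∪ S
  let AI : Finset (Fin n →₀ ℕ) := A.filter fun α => ∀ i, ¬ I i → α i = 0
  have hAI : AI.Nonempty := by
    obtain ⟨α, hα, h⟩ := exists_support_eq_zero_off hconv i₀
    exact ⟨α, Finset.mem_filter.2 ⟨Finset.mem_union_left _ hα, fun i hi =>
      h i (by rintro rfl; exact hi hi₀)⟩⟩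
  have hAf : ∀ α ∈ A, expR α ∈ NewtonPolyhedron f := fun α hα =>
    (Finset.mem_union.1 hα).elim (fun h => expR_mem_newtonRegion h)
      fun h => hPsub ((hS α).1 h)
  let x' : ℕ → Fin n → ℂ := fun k i => if x k i = 0 then 1 else x k i
  have hx' : ∀ k i, x' k i ≠ 0 := by
    intro k i
    by_cases h : x k i = 0 <;> simp [x', h]
  obtain ⟨F, hFAI, α₀, hα₀, w, z, hz, hzlim, hwF, hwA⟩ := exists_torus_limit l x' hx' hAI
  have hwpos : ∀ᶠ k in l, ∀ i, I i → 0 < w k i := by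
    refine eventually_all.2 fun i => ?_
    by_cases hi : I i
    · have hzi : 0 < ‖z i‖ / 2 := half_pos (norm_pos_iff.2 (hz i))
      have h1 : ∀ᶠ k in l, ‖x k i‖ < ‖z i‖ / 2 := by
        have := (tendsto_pi_nhds.1 hxlim i).norm
        rw [Pi.zero_apply, norm_zero] at this
        exact this.eventually_lt_const hzi
      have h2 : ∀ᶠ k in l, ‖z i‖ / 2 < ‖x' k i * (Real.exp (w k i) : ℂ)‖ :=
        (tendsto_pi_nhds.1 hzlim i).norm.eventually_const_lt (half_lt_self (norm_pos_iff.2 (hz i)))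
      filter_upwards [hi, h1, h2] with k hk h1 h2 _
      by_contra! hle
      rw [norm_mul, Complex.norm_real, Real.norm_of_nonneg (Real.exp_pos _).le] at h2
      simp only [x', if_neg hk] at h2
      have := mul_le_of_le_one_right (norm_nonneg (x k i)) (Real.exp_le_one_iff.2 hle)
      linarith
    · exact Eventually.of_forall fun k h => absurd h hi
  have hwgt : ∀ᶠ k in l, ∀ α ∈ AI, α ∉ F → w k ⬝ᵥ expR α₀ < w k ⬝ᵥ expR α := by
    refine (Finset.eventually_all AI).2 fun α hα => ?_
    by_cases hαF : α ∈ F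
    · exact Eventually.of_forall fun k h => absurd hαF h
    · filter_upwards [(hwA α hα hαF).eventually_gt_atTop 0] with k hk _
      linarith
  obtain ⟨k₀, hk₀pos, hk₀gt⟩ := (hwpos.and hwgt).exists
  let N : ℝ := |w k₀ ⬝ᵥ expR α₀| + 1
  let W : Fin n → ℝ := fun i => if I i then w k₀ i else N
  have hNpos : 0 < N := by positivity
  have hW : ∀ i, 0 < W i := by
    intro i
    by_cases hi : I i
    · simpa [W, hi] using hk₀pos i hi
    · simpa [W, hi] using hNpos
  have hWAI : ∀ α ∈ AI, W ⬝ᵥ expR α = w k₀ ⬝ᵥ expR α := by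
    intro α hα
    refine Finset.sum_congr rfl fun i _ => ?_
    by_cases hi : I i
    · simp [W, hi]
    · simp [expR, (Finset.mem_filter.1 hα).2 i hi]
  have hWA : ∀ α ∈ A, α ∉ AI → W ⬝ᵥ expR α₀ < W ⬝ᵥ expR α := by
    intro α hα hαI
    obtain ⟨i, hi, hαi⟩ : ∃ i, ¬ I i ∧ α i ≠ 0 := by
      by_contra! h
      exact hαI (Finset.mem_filter.2 ⟨hα, h⟩)
    have h1 : W i * expR α i ≤ W ⬝ᵥ expR α :=
      Finset.single_le_sum (f := fun j => W j * expR α j)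
        (fun j _ => mul_nonneg (hW j).le (Nat.cast_nonneg _)) (Finset.mem_univ i)
    have h2 : (1 : ℝ) ≤ expR α i := Nat.one_le_cast.2 (Nat.one_le_iff_ne_zero.2 hαi)
    have h3 : W i = N := if_neg hi
    rw [hWAI α₀ (hFAI hα₀)]
    have h4 : N ≤ N * expR α i := le_mul_of_one_le_right hNpos.le h2
    have h5 := le_abs_self (w k₀ ⬝ᵥ expR α₀)
    rw [h3] at h1
    linarith [show N = |w k₀ ⬝ᵥ expR α₀| + 1 from rfl]
  have hWF : ∀ α ∈ A, α ∉ F → W ⬝ᵥ expR α₀ < W ⬝ᵥ expR α := by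
    intro α hα hαF
    by_cases hαI : α ∈ AI
    · rw [hWAI α₀ (hFAI hα₀), hWAI α hαI]
      exact hk₀gt α hαI hαF
    · exact hWA α hα hαI
  have hWeq : ∀ α ∈ F, W ⬝ᵥ expR α = W ⬝ᵥ expR α₀ := by
    intro α hα
    rw [hWAI α (hFAI hα), hWAI α₀ (hFAI hα₀), hwF α hα k₀]
  have hAIA : AI ⊆ A := Finset.filter_subset _ _
  have hfilter : (A.filter fun α => W ⬝ᵥ expR α = W ⬝ᵥ expR α₀) = F := by
    ext α
    rw [Finset.mem_filter]
    exact ⟨fun h => by_contra fun hF => (hWF α h.1 hF).ne' h.2,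
      fun h => ⟨hAIA (hFAI h), hWeq α h⟩⟩
  have hno := not_hasTorusSolution_sum_filter hy₀bd hy₀nd (support_perturb_subset f S y₀) hAf hW
    (hAIA (hFAI hα₀)) (fun α hα => by
      by_cases hαF : α ∈ F
      · exact (hWeq α hαF).ge
      · exact (hWF α hα hαF).le)
  rw [hfilter] at hno
  have hlimit : ∀ m : (Fin n →₀ ℕ) → ℂ,
      (∀ k, ∑ α ∈ A, (perturb f S (y k)).coeff α * m α * ∏ i, x k i ^ α i = 0) →
      ∑ α ∈ F, (perturb f S y₀).coeff α * m α * ∏ i, z i ^ α i = 0 := by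
    intro m hm
    refine sum_minimal_terms_eq_zero hzlim hFAI hwF hwA
      (c := fun k α => (perturb f S (y k)).coeff α * m α)
      (c₀ := fun α => (perturb f S y₀).coeff α * m α)
      (fun α _ => (((continuous_coeff_perturb f S α).tendsto y₀).comp hylim).mul_const _) ?_
    filter_upwards [hI] with k hk
    rw [← hm k]
    refine Finset.sum_subset_zero_on_sdiff hAIA (fun α hα => ?_) (fun α hα => ?_)
    · obtain ⟨i, hi, hαi⟩ : ∃ i, ¬ I i ∧ α i ≠ 0 := by
        by_contra! h
        rw [Finset.mem_sdiff] at hα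
        exact hα.2 (Finset.mem_filter.2 ⟨hα.1, h⟩)
      rw [Finset.prod_eq_zero (Finset.mem_univ i), mul_zero]
      rw [(hk i).2 hi, zero_pow hαi]
    · congr 1
      refine Finset.prod_congr rfl fun i _ => ?_
      by_cases hi : x k i = 0
      · simp [(Finset.mem_filter.1 hα).2 i ((hk i).1 hi)]
      · simp [x', hi]
  have hexpand : ∀ k, perturb f S (y k) =
      ∑ α ∈ A, monomial α ((perturb f S (y k)).coeff α) := by
    intro k
    conv_lhs => rw [(perturb f S (y k)).as_sum]
    refine Finset.sum_subset (support_perturb_subset f S (y k)) fun α _ hα => ?_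
    rw [notMem_support_iff.1 hα, map_zero]
  refine hno ⟨z, hz, ?_, fun j => ?_⟩
  · rw [eval_sum_monomial]
    have h := hlimit (fun _ => 1) fun k => by
      have h1 := (hxsing k).1
      rw [hexpand k, eval_sum_monomial] at h1
      simpa using h1
    simpa using h
  · refine (mul_eq_zero.1 ?_).resolve_left (hz j)
    rw [mul_eval_pderiv_sum_monomial]
    refine hlimit (fun α => (α j : ℂ)) fun k => ?_
    rw [← mul_eval_pderiv_sum_monomial, ← hexpand k, (hxsing k).2 j, mul_zero]
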